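/- arXiv:1809.10751 — 5 statements merged into one kernel-verified Lean document; each statement's English description precedes it below -/
import Mathlib

section
/- Let d ≥ 2 and N ≥ 1 be integers, and set x := 1/d² and y := 1/N + (1 − 1/N)/d². Then √(x·y) + √((1−x)·(1−y)) ≤ 1 − ((d²−1)/(8N²)) · 1/(1 + (d²−2)/(2N)). -/
/-- One Newton step from `1 + u/2` bounds the square root from above. -/
lemma sqrt_newton_bound (u : ℝ) (hu : -1 ≤ u) :
    Real.sqrt (1 + u) ≤ 1 + u / 2 - u ^ 2 / (4 * (2 + u)) := by
  have h2 : (0 : ℝ) < 2 + u := by linarith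
  have hs := Real.sq_sqrt (show (0 : ℝ) ≤ 1 + u by linarith)
  set s := Real.sqrt (1 + u)
  have e : 1 + u / 2 - u ^ 2 / (4 * (2 + u)) - s = (2 + u - 2 * s) ^ 2 / (4 * (2 + u)) := by
    field_simp
    nlinarith [hs]
  have : 0 ≤ (2 + u - 2 * s) ^ 2 / (4 * (2 + u)) := by positivity
  linarith

/-- Convexity of the reciprocal, in the form needed below. -/
lemma reciprocal_bound (k t : ℝ) (hk : 1 ≤ k) (ht : 0 < t) (ht1 : t ≤ 1) :
    (k + 1) * (k * t ^ 2 / (4 * (2 + (k - 1) * t))) ≤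
      (k * t) ^ 2 / (4 * (2 + k * t)) + k * (t ^ 2 / (4 * (2 - t))) := by
  have h1 : 0 < 2 + (k - 1) * t := by nlinarith
  have h2 : 0 < 2 + k * t := by nlinarith
  have h3 : 0 < 2 - t := by linarith
  have h4 : 2 + t * (k - 1) ≠ 0 := by
    rw [mul_comm]; exact h1.ne'
  have e : (k * t) ^ 2 / (4 * (2 + k * t)) + k * (t ^ 2 / (4 * (2 - t))) -
      (k + 1) * (k * t ^ 2 / (4 * (2 + (k - 1) * t))) =
      k ^ 2 * t ^ 4 * (k + 1) / (4 * (2 + k * t) * (2 - t) * (2 + (k - 1) * t)) := by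
    field_simp
    ring
  have : 0 ≤ k ^ 2 * t ^ 4 * (k + 1) /
      (4 * (2 + k * t) * (2 - t) * (2 + (k - 1) * t)) := by positivity
  linarith

/-- For integers `d ≥ 2`, `N ≥ 1`, with `x = 1/d²` and
`y = 1/N + (1 - 1/N)/d²`, the binary root fidelity satisfies
`√(xy) + √((1-x)(1-y)) ≤ 1 - ((d²-1)/(8N²)) · 1/(1 + (d²-2)/(2N))`. -/
theorem binary_root_fidelity_bound (d N : ℕ) (hd : 2 ≤ d) (hN : 1 ≤ N) :
    Real.sqrt ((1 / (d : ℝ) ^ 2) * (1 / (N : ℝ) + (1 - 1 / (N : ℝ)) / (d : ℝ) ^ 2)) +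
      Real.sqrt ((1 - 1 / (d : ℝ) ^ 2) *
        (1 - (1 / (N : ℝ) + (1 - 1 / (N : ℝ)) / (d : ℝ) ^ 2))) ≤
    1 - (((d : ℝ) ^ 2 - 1) / (8 * (N : ℝ) ^ 2)) *
      (1 / (1 + ((d : ℝ) ^ 2 - 2) / (2 * (N : ℝ)))) := by
  have hd' : (2 : ℝ) ≤ d := by exact_mod_cast hd
  have hN' : (1 : ℝ) ≤ N := by exact_mod_cast hN
  have hd0 : (0 : ℝ) < d := by linarith
  have hN0 : (0 : ℝ) < N := by linarith
  obtain ⟨k, hk⟩ : ∃ k : ℝ, k = (d : ℝ) ^ 2 - 1 := ⟨_, rfl⟩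
  obtain ⟨t, ht⟩ : ∃ t : ℝ, t = 1 / (N : ℝ) := ⟨_, rfl⟩
  have hD : (d : ℝ) ^ 2 = k + 1 := by linarith
  have hNt : (N : ℝ) = 1 / t := by rw [ht]; simp
  have ht0 : 0 < t := by rw [ht]; positivity
  have ht1 : t ≤ 1 := by rw [ht, div_le_one hN0]; exact hN'
  have hk1 : 1 ≤ k := by nlinarith
  have hk0 : 0 < k + 1 := by linarith
  rw [hD, hNt]
  have e1 : 1 / (k + 1) * (1 / (1 / t) + (1 - 1 / (1 / t)) / (k + 1)) =
      (1 + k * t) / (k + 1) ^ 2 := by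
    field_simp
    ring
  have e2 : (1 - 1 / (k + 1)) * (1 - (1 / (1 / t) + (1 - 1 / (1 / t)) / (k + 1))) =
      (1 + -t) * (k / (k + 1)) ^ 2 := by
    field_simp
    ring
  have h1 : 0 < 2 + (k - 1) * t := by nlinarith
  have h1' : 0 < 1 + (k + 1 - 2) / (2 * (1 / t)) := by
    have : 1 + (k + 1 - 2) / (2 * (1 / t)) = (2 + (k - 1) * t) / 2 := by
      field_simp
      ring
    rw [this]; positivity
  have e3 : (k + 1 - 1) / (8 * (1 / t) ^ 2) * (1 / (1 + (k + 1 - 2) / (2 * (1 / t)))) =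
      k * t ^ 2 / (4 * (2 + (k - 1) * t)) := by
    have : 1 + (k + 1 - 2) / (2 * (1 / t)) = (2 + (k - 1) * t) / 2 := by
      field_simp
      ring
    rw [this]
    field_simp
    ring
  rw [e1, e2, e3, Real.sqrt_div' _ (by positivity), Real.sqrt_sq hk0.le,
    Real.sqrt_mul (by linarith), Real.sqrt_sq (by positivity)]
  have a := sqrt_newton_bound (k * t) (by nlinarith)
  have b := sqrt_newton_bound (-t) (by linarith)
  have c := reciprocal_bound k t hk1 ht0 ht1
  have b' : Real.sqrt (1 + -t) ≤ 1 - t / 2 - t ^ 2 / (4 * (2 - t)) := by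
    convert b using 1
    ring
  have b2 := mul_le_mul_of_nonneg_left b' (show 0 ≤ k by linarith)
  have e4 : Real.sqrt (1 + k * t) / (k + 1) + Real.sqrt (1 + -t) * (k / (k + 1)) =
      (Real.sqrt (1 + k * t) + k * Real.sqrt (1 + -t)) / (k + 1) := by
    field_simp
  rw [e4, div_le_iff₀ hk0]
  linarith
end

section
/- Let d ≥ 1 and n ≥ 1 be integers and let α = (α_1,…,α_d) be natural numbers with α_1 + ⋯ + α_d = n. Then d^{−n} · n!/(α_1! ⋯ α_d!) ≤ C_d · n^{−(d−1)/2} · ( ∏_{i=1}^d (α_i/n + 1/n)^{−1/2} ) · exp( −(n/2) · ( ∑_{i=1}^d |α_i/n − 1/d| )² ), where C_d := e^{d+1}/(2π)^{d/2}. -/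
open scoped BigOperators
open Finset

lemma aux_hasDeriv (x : ℝ) (hx : 0 < x) :
    HasDerivAt (fun x : ℝ => Real.log x - (5*x^2-4*x-1)/(2*(x^2+2*x)))
      ((x-1)^3/(x^2*(x+2)^2)) x := by
  have h1 := Real.hasDerivAt_log hx.ne'
  have hne : (2*(x^2+2*x)) ≠ 0 := by positivity
  have hnum : HasDerivAt (fun x : ℝ => 5*x^2-4*x-1) (10*x-4) x := by
    have := (((hasDerivAt_pow 2 x).const_mul 5).sub ((hasDerivAt_id x).const_mul 4)).sub_const 1
    refine this.congr_deriv ?_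
    norm_num; try ring
  have hden : HasDerivAt (fun x : ℝ => 2*(x^2+2*x)) (4*x+4) x := by
    have := ((hasDerivAt_pow 2 x).add ((hasDerivAt_id x).const_mul 2)).const_mul 2
    refine this.congr_deriv ?_
    norm_num; try ring
  refine (h1.sub (hnum.div hden hne)).congr_deriv ?_
  field_simp
  ring

lemma aux_log (x : ℝ) (hx : 0 < x) :
    (5*x^2-4*x-1)/(2*(x^2+2*x)) ≤ Real.log x := by
  set f := (fun x : ℝ => Real.log x - (5*x^2-4*x-1)/(2*(x^2+2*x))) with hf
  have hf1 : f 1 = 0 := by simp [hf]; norm_num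
  suffices 0 ≤ f x by simpa [hf] using this
  rw [← hf1]
  rcases le_total 1 x with h | h
  · have : MonotoneOn f (Set.Ici 1) := by
      apply monotoneOn_of_deriv_nonneg (convex_Ici 1)
      · intro y hy
        exact (aux_hasDeriv y (lt_of_lt_of_le one_pos hy)).continuousAt.continuousWithinAt
      · intro y hy
        rw [interior_Ici] at hy
        exact (aux_hasDeriv y (lt_trans one_pos hy)).differentiableAt.differentiableWithinAt
      · intro y hy
        rw [interior_Ici] at hy
        have hy' : 1 < y := hy
        rw [(aux_hasDeriv y (lt_trans one_pos hy)).deriv]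
        have : 0 < y - 1 := by linarith
        positivity
    exact this (Set.mem_Ici.2 le_rfl) h h
  · have : AntitoneOn f (Set.Ioc 0 1) := by
      apply antitoneOn_of_deriv_nonpos (convex_Ioc 0 1)
      · intro y hy
        exact (aux_hasDeriv y hy.1).continuousAt.continuousWithinAt
      · intro y hy
        rw [interior_Ioc] at hy
        exact (aux_hasDeriv y hy.1).differentiableAt.differentiableWithinAt
      · intro y hy
        rw [interior_Ioc] at hy
        rw [(aux_hasDeriv y hy.1).deriv]
        apply div_nonpos_of_nonpos_of_nonneg
        · exact Odd.pow_nonpos (by decide) (by linarith [hy.2])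
        · positivity
    exact this ⟨hx, h⟩ ⟨one_pos, le_rfl⟩ h

lemma aux_phi (x : ℝ) (hx : 0 ≤ x) :
    x - 1 + 3*(x-1)^2/(2*(x+2)) ≤ x * Real.log x := by
  rcases hx.eq_or_lt with rfl | hx
  · norm_num
  · refine le_trans (le_of_eq ?_) (mul_le_mul_of_nonneg_left (aux_log x hx) hx.le)
    field_simp
    ring

lemma aux_pinsker (d : ℕ) (hd : 1 ≤ d) (p : Fin d → ℝ) (hp : ∀ i, 0 ≤ p i)
    (hs : ∑ i, p i = 1) :
    (∑ i, |p i - 1/(d:ℝ)|)^2 / 2 ≤ ∑ i, p i * Real.log (d * p i) := by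
  have hd0 : (0:ℝ) < d := by exact_mod_cast hd
  have hpos : ∀ i ∈ (Finset.univ : Finset (Fin d)), 0 < p i + 2/(d:ℝ) := by
    intro i _
    have := hp i
    positivity
  have h1 := Finset.sq_sum_div_le_sum_sq_div Finset.univ (fun i => |p i - 1/(d:ℝ)|) hpos
  have h2 : ∑ i, (p i + 2/(d:ℝ)) = 3 := by
    rw [Finset.sum_add_distrib, hs]
    simp
    field_simp
    norm_num
  rw [h2] at h1
  have h3 : ∀ i, p i - 1/(d:ℝ) + 3/2 * (|p i - 1/(d:ℝ)|^2/(p i + 2/(d:ℝ)))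
      ≤ p i * Real.log (d * p i) := by
    intro i
    have h0 := hp i
    have := aux_phi (d * p i) (by positivity)
    have h4 : p i * Real.log (d * p i) = (1/(d:ℝ)) * (d * p i * Real.log (d * p i)) := by
      field_simp
    rw [h4]
    refine le_trans (le_of_eq ?_) (mul_le_mul_of_nonneg_left this (by positivity))
    rw [sq_abs]
    have : (d * p i + 2) ≠ 0 := by positivity
    have : p i + 2/(d:ℝ) ≠ 0 := by positivity
    have : p i * d + 2 ≠ 0 := by positivity
    field_simp
  have h5 := Finset.sum_le_sum (fun i (_ : i ∈ Finset.univ) => h3 i)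
  rw [Finset.sum_add_distrib, ← Finset.mul_sum, Finset.sum_sub_distrib, hs] at h5
  have h6 : ∑ i : Fin d, 1/(d:ℝ) = 1 := by
    simp [hd0.ne']
  rw [h6] at h5
  linarith

lemma aux_upper (n : ℕ) (hn : 1 ≤ n) :
    (n.factorial : ℝ) ≤ Real.exp 1 * Real.sqrt n * (n / Real.exp 1)^n := by
  obtain ⟨m, rfl⟩ : ∃ m, n = m + 1 := ⟨n - 1, by omega⟩
  have h := Stirling.stirlingSeq'_antitone (Nat.zero_le m)
  simp only [Function.comp, Nat.succ_eq_add_one, zero_add, Stirling.stirlingSeq_one] at h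
  rw [Stirling.stirlingSeq, div_le_iff₀ (by positivity)] at h
  refine h.trans (le_of_eq ?_)
  rw [Real.sqrt_mul (by norm_num)]
  field_simp

lemma aux_lower (a : ℕ) :
    Real.sqrt (2*Real.pi) * Real.sqrt (a+1) * (a / Real.exp 1)^a ≤ Real.exp 1 * a.factorial := by
  have he := Real.exp_one_gt_d9
  rcases Nat.eq_zero_or_pos a with rfl | ha
  · simp
    rw [← Real.sqrt_mul (by norm_num), Real.sqrt_le_left (by positivity)]
    nlinarith [Real.pi_lt_d2]
  · have h := Stirling.le_factorial_stirling a
    have ha' : (1:ℝ) ≤ a := by exact_mod_cast ha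
    have h2 : Real.sqrt (a+1) ≤ Real.exp 1 * Real.sqrt a := by
      rw [Real.sqrt_le_left (by positivity), mul_pow, Real.sq_sqrt (by positivity)]
      have h4 : 4 ≤ Real.exp 1 ^ 2 := by nlinarith
      nlinarith
    calc _ ≤ Real.sqrt (2*Real.pi) * (Real.exp 1 * Real.sqrt a) * (a / Real.exp 1)^a := by gcongr
      _ = Real.exp 1 * (Real.sqrt (2 * Real.pi * a) * (a / Real.exp 1)^a) := by
        rw [Real.sqrt_mul (by positivity) (a:ℝ)]; ring
      _ ≤ _ := by gcongr

lemma aux_prod (d n : ℕ) (hd : 1 ≤ d) (hn : 1 ≤ n)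
    (α : Fin d → ℕ) (hsum : ∑ i, α i = n) :
    Real.exp (((n : ℝ) / 2) * (∑ i, |(α i : ℝ) / (n : ℝ) - 1 / (d : ℝ)|) ^ 2) * (n:ℝ)^n
      ≤ (d:ℝ)^n * ∏ i, (α i : ℝ)^(α i) := by
  have hd0 : (0:ℝ) < d := by exact_mod_cast hd
  have hn0 : (0:ℝ) < n := by exact_mod_cast hn
  have hp := aux_pinsker d hd (fun i => (α i : ℝ)/n) (fun i => by positivity) (by
    rw [← Finset.sum_div, ← Nat.cast_sum, hsum]; field_simp)
  have h1 : ∀ i, ((d:ℝ) * ((α i:ℝ)/n))^(α i)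
      = Real.exp (n * ((α i : ℝ)/n * Real.log (d * ((α i:ℝ)/n)))) := by
    intro i
    rcases Nat.eq_zero_or_pos (α i) with h | h
    · simp [h]
    · have : (0:ℝ) < α i := by exact_mod_cast h
      have h2 : (n:ℝ) * ((α i : ℝ)/n * Real.log (d * ((α i:ℝ)/n)))
        = (α i : ℝ) * Real.log (d * ((α i:ℝ)/n)) := by field_simp
      rw [h2, Real.exp_nat_mul, Real.exp_log (by positivity)]
  have h2 : ∏ i, ((d:ℝ) * ((α i:ℝ)/n))^(α i)
      = ((d:ℝ)^n * ∏ i, (α i : ℝ)^(α i)) / (n:ℝ)^n := by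
    simp_rw [mul_pow, div_pow]
    rw [Finset.prod_mul_distrib, Finset.prod_div_distrib, Finset.prod_pow_eq_pow_sum,
      Finset.prod_pow_eq_pow_sum, hsum]
    ring
  rw [← le_div_iff₀ (by positivity), ← h2]
  simp_rw [h1]
  rw [← Real.exp_sum, ← Finset.mul_sum]
  apply Real.exp_le_exp.2
  calc _ = (n:ℝ) * ((∑ i, |(α i : ℝ) / (n : ℝ) - 1 / (d : ℝ)|) ^ 2 / 2) := by ring
    _ ≤ _ := by gcongr

/-- Multinomial/Stirling/Pinsker bound: for `α : Fin d → ℕ` with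
`∑ α_i = n`,
`d^{-n} · n!/(α₁!⋯α_d!) ≤ C_d · n^{-(d-1)/2} · ∏ (α_i/n + 1/n)^{-1/2}
  · exp(-(n/2)(∑|α_i/n - 1/d|)²)` with `C_d = e^{d+1}/(2π)^{d/2}`. -/
theorem multinomial_gaussian_bound (d n : ℕ) (hd : 1 ≤ d) (hn : 1 ≤ n)
    (α : Fin d → ℕ) (hsum : ∑ i, α i = n) :
    ((d : ℝ) ^ n)⁻¹ * ((n.factorial : ℝ) / ∏ i, ((α i).factorial : ℝ)) ≤
      (Real.exp ((d : ℝ) + 1) / (2 * Real.pi) ^ ((d : ℝ) / 2)) *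
        (n : ℝ) ^ (-(((d : ℝ) - 1) / 2)) *
        (∏ i, ((α i : ℝ) / (n : ℝ) + 1 / (n : ℝ)) ^ (-(1 : ℝ) / 2)) *
        Real.exp (-((n : ℝ) / 2) * (∑ i, |(α i : ℝ) / (n : ℝ) - 1 / (d : ℝ)|) ^ 2) := by
  have hd0 : (0:ℝ) < d := by exact_mod_cast hd
  have hn0 : (0:ℝ) < n := by exact_mod_cast hn
  have hP := aux_prod d n hd hn α hsum
  have hU := aux_upper n hn
  have hL := Finset.prod_le_prod (s := Finset.univ) (fun i _ => by positivity)
    (fun i (_ : i ∈ Finset.univ) => aux_lower (α i))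
  simp only [Finset.prod_mul_distrib, Finset.prod_const, Finset.card_univ, Fintype.card_fin,
    div_pow, Finset.prod_div_distrib, Finset.prod_pow_eq_pow_sum, hsum] at hL
  rw [div_pow] at hU
  have e1 : (2 * Real.pi) ^ ((d : ℝ) / 2) = Real.sqrt (2*Real.pi)^d := by
    rw [Real.sqrt_eq_rpow, ← Real.rpow_natCast, ← Real.rpow_mul (by positivity)]
    congr 1; ring
  have e2 : Real.exp ((d:ℝ)+1) = Real.exp 1 ^ d * Real.exp 1 := by
    rw [Real.exp_add, ← Real.exp_nat_mul, mul_one]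
  have e3 : ∏ i, ((α i : ℝ) / (n : ℝ) + 1 / (n : ℝ)) ^ (-(1 : ℝ) / 2)
      = Real.sqrt n ^ d / ∏ i, Real.sqrt (α i + 1) := by
    have : ∀ i, ((α i : ℝ) / (n : ℝ) + 1 / (n : ℝ)) ^ (-(1 : ℝ) / 2)
        = Real.sqrt n / Real.sqrt (α i + 1) := by
      intro i
      rw [← add_div, neg_div, Real.rpow_neg (by positivity), ← Real.sqrt_eq_rpow,
        Real.sqrt_div (by positivity), inv_div]
    simp_rw [this]
    rw [Finset.prod_div_distrib]
    simp
  have e4 : (n : ℝ) ^ (-(((d : ℝ) - 1) / 2)) = Real.sqrt n / Real.sqrt n ^ d := by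
    rw [Real.sqrt_eq_rpow, ← Real.rpow_natCast, ← Real.rpow_mul (by positivity),
      ← Real.rpow_sub hn0]
    congr 1; ring
  rw [e1, e2, e3, e4, neg_mul, Real.exp_neg]
  set V := Real.exp (((n : ℝ) / 2) * (∑ i, |(α i : ℝ) / (n : ℝ) - 1 / (d : ℝ)|) ^ 2)
  have hV : 0 < V := Real.exp_pos _
  set F := ∏ i, ((α i).factorial : ℝ)
  have hF : 0 < F := Finset.prod_pos (fun i _ => by positivity)
  set S := ∏ i, Real.sqrt ((α i : ℝ) + 1)
  have hS : 0 < S := Finset.prod_pos (fun i _ => by positivity)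
  set A := ∏ i, (α i : ℝ)^(α i)
  have hA : 0 < A := Finset.prod_pos (fun i _ => by
    rcases Nat.eq_zero_or_pos (α i) with h | h
    · simp [h]
    · positivity)
  set q := Real.sqrt (2*Real.pi)^d
  have hq : 0 < q := by positivity
  set s := Real.sqrt n
  have hs : 0 < s := Real.sqrt_pos.2 hn0
  set E := Real.exp 1
  have hE : 0 < E := Real.exp_pos 1
  have hR : E ^ d * E / q * (s / s ^ d) * (s ^ d / S) * V⁻¹ = E^d * E * s / (q * S * V) := by
    field_simp
  rw [hR, inv_mul_eq_div, div_div, div_le_div_iff₀ (by positivity) (by positivity)]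
  have hL' : q * S * A ≤ E^d * F * E^n := by
    have : q * S * (A / E^n) = q * S * A / E^n := by ring
    rw [this, div_le_iff₀ (by positivity)] at hL
    exact hL
  have key : (n.factorial : ℝ) * (q * S * V) * (E^n * A)
      ≤ E^d * E * s * (F * (d:ℝ)^n) * (E^n * A) := by
    calc (n.factorial : ℝ) * (q * S * V) * (E^n * A)
        ≤ (E * s * ((n:ℝ)^n / E^n)) * (q * S * V) * (E^n * A) := by gcongr
      _ = E * s * (q * S * A) * (V * (n:ℝ)^n) := by field_simp
      _ ≤ E * s * (E^d * F * E^n) * ((d:ℝ)^n * A) := by gcongr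
      _ = _ := by ring
  exact le_of_mul_le_mul_right key (by positivity)
end

section
/- Let d ≥ 1 be an integer and ε ∈ [0,1]. Let ρ be a density matrix on ℂ^d ⊗ ℂ^d with ⟨φ⁺| ρ |φ⁺⟩ ≥ 1 − ε², where |φ⁺⟩ := (1/√d) ∑_{k=1}^d |k⟩ ⊗ |k⟩. Let ρ_A denote the partial trace of ρ over the second tensor factor, let σ be any density matrix on ℂ^d, and let c ≥ 0 be such that c · (ρ_A ⊗ σ) − ρ is positive semidefinite. Then c ≥ d² (1 − ε²)². (In information-theoretic terms: the ε-smooth max-mutual information of the maximally entangled state satisfies I_max^ε(A:B)_{φ⁺} ≥ 2 log(d(1−ε²)).) -/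
open scoped BigOperators ComplexOrder
open Finset

namespace PBT

/-- The projector onto the maximally entangled state
`|φ⁺⟩ = (1/√d) ∑_k |k⟩⊗|k⟩` on `ℂ^d ⊗ ℂ^d`, with entries
`φ⁺[(i,j),(i',j')] = (1/d)·[i = j]·[i' = j']`. -/
noncomputable def phiPlusProj (d : ℕ) : Matrix (Fin d × Fin d) (Fin d × Fin d) ℂ :=
  fun x y => if x.1 = x.2 ∧ y.1 = y.2 then (d : ℂ)⁻¹ else 0

/-- Partial trace over the second tensor factor. -/
noncomputable def ptraceB (d : ℕ) (ρ : Matrix (Fin d × Fin d) (Fin d × Fin d) ℂ) :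
    Matrix (Fin d) (Fin d) ℂ :=
  fun i i' => ∑ j : Fin d, ρ (i, j) (i', j)


open Matrix

open scoped MatrixOrder in
lemma psd_fac {n : Type*} [Fintype n] [DecidableEq n] {P : Matrix n n ℂ} (hP : P.PosSemidef) :
    ∃ Q : Matrix n n ℂ, P = Qᴴ * Q :=
  CStarAlgebra.nonneg_iff_eq_star_mul_self.mp hP.nonneg

/-- Cauchy–Schwarz for a positive semidefinite form. -/
lemma psd_cs {n : Type*} [Fintype n] [DecidableEq n] {P : Matrix n n ℂ} (hP : P.PosSemidef)
    (x y : n → ℂ) :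
    ‖star x ⬝ᵥ P *ᵥ y‖ ^ 2 ≤ (star x ⬝ᵥ P *ᵥ x).re * (star y ⬝ᵥ P *ᵥ y).re := by
  obtain ⟨Q, rfl⟩ := psd_fac hP
  have key : ∀ a b : n → ℂ, star a ⬝ᵥ (Qᴴ * Q) *ᵥ b
      = inner ℂ (WithLp.toLp 2 (Q *ᵥ a)) (WithLp.toLp 2 (Q *ᵥ b)) := by
    intro a b
    rw [EuclideanSpace.inner_toLp_toLp, ← Matrix.mulVec_mulVec, Matrix.dotProduct_mulVec,
      ← Matrix.star_mulVec, dotProduct_comm]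
  have h := inner_mul_inner_self_le (𝕜 := ℂ) (WithLp.toLp 2 (Q *ᵥ x)) (WithLp.toLp 2 (Q *ᵥ y))
  rw [norm_inner_symm (WithLp.toLp 2 (Q *ᵥ y)), ← sq] at h
  rw [key, key, key]
  exact h

lemma psd_trace_mul {n : Type*} [Fintype n] [DecidableEq n] {K S : Matrix n n ℂ}
    (hK : K.PosSemidef) (hS : S.PosSemidef) : 0 ≤ (K * S).trace := by
  obtain ⟨Q, rfl⟩ := psd_fac hS
  rw [← Matrix.mul_assoc, Matrix.trace_mul_comm, ← Matrix.mul_assoc]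
  exact (hK.mul_mul_conjTranspose_same Q).trace_nonneg

/-- The product vector `x ⊗ e_j`. -/
def tens {d : ℕ} (x : Fin d → ℂ) (j : Fin d) : Fin d × Fin d → ℂ :=
  fun p => if p.2 = j then x p.1 else 0

/-- Unnormalized maximally entangled vector. -/
def sv (d : ℕ) : Fin d × Fin d → ℂ := fun p => if p.1 = p.2 then 1 else 0

/-- Vectorization. -/
def vc {d : ℕ} (W : Matrix (Fin d) (Fin d) ℂ) : Fin d × Fin d → ℂ := fun p => W p.1 p.2

lemma tens_dot {d : ℕ} (x : Fin d → ℂ) (j : Fin d) (u : Fin d × Fin d → ℂ) :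
    star (tens x j) ⬝ᵥ u = ∑ i, star (x i) * u (i, j) := by
  simp [dotProduct, tens, Fintype.sum_prod_type, apply_ite]

lemma ptrace_form {d : ℕ} (ρ : Matrix (Fin d × Fin d) (Fin d × Fin d) ℂ) (x : Fin d → ℂ) :
    star x ⬝ᵥ ptraceB d ρ *ᵥ x = ∑ j, star (tens x j) ⬝ᵥ ρ *ᵥ tens x j := by
  simp only [tens_dot]
  simp [dotProduct, mulVec, ptraceB, tens, Fintype.sum_prod_type, Finset.mul_sum, Finset.sum_mul]
  rw [Finset.sum_comm_cycle]


lemma ptrace_psd {d : ℕ} {ρ : Matrix (Fin d × Fin d) (Fin d × Fin d) ℂ} (hρ : ρ.PosSemidef) :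
    (ptraceB d ρ).PosSemidef := by
  refine Matrix.PosSemidef.of_dotProduct_mulVec_nonneg ?_ fun x => ?_
  · ext i j
    simp only [ptraceB, conjTranspose_apply, star_sum]
    exact Finset.sum_congr rfl fun k _ => hρ.1.apply _ _
  · rw [ptrace_form]
    exact Finset.sum_nonneg fun j _ => hρ.dotProduct_mulVec_nonneg _

lemma kron_form {d : ℕ} (A σ V W : Matrix (Fin d) (Fin d) ℂ) :
    star (vc V) ⬝ᵥ (Matrix.kroneckerMap (· * ·) A σ) *ᵥ vc W = ((Vᴴ * A * W) * σᵀ).trace := by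
  simp only [dotProduct, mulVec, vc, Fintype.sum_prod_type, Matrix.trace, Matrix.mul_apply,
    Matrix.diag, Finset.mul_sum, Finset.sum_mul, kroneckerMap_apply, Pi.star_apply,
    conjTranspose_apply, transpose_apply]
  rw [Finset.sum_comm]
  refine Finset.sum_congr rfl fun j _ => ?_
  rw [Finset.sum_comm_cycle]
  refine Finset.sum_congr rfl fun k _ => ?_
  rw [Finset.sum_comm]
  refine Finset.sum_congr rfl fun l _ => Finset.sum_congr rfl fun i _ => ?_
  ring

lemma vc_dot {d : ℕ} (V W : Matrix (Fin d) (Fin d) ℂ) :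
    star (vc V) ⬝ᵥ vc W = (Vᴴ * W).trace := by
  simp only [dotProduct, vc, Fintype.sum_prod_type, Matrix.trace, Matrix.mul_apply,
    Matrix.diag, Pi.star_apply, conjTranspose_apply]
  rw [Finset.sum_comm]

lemma sv_eq (d : ℕ) : sv d = vc 1 := by
  ext p; simp [sv, vc, Matrix.one_apply]

lemma trace_phi (d : ℕ) (ρ : Matrix (Fin d × Fin d) (Fin d × Fin d) ℂ) :
    Matrix.trace (ρ * phiPlusProj d) = (d : ℂ)⁻¹ * (star (sv d) ⬝ᵥ ρ *ᵥ sv d) := by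
  simp only [Matrix.trace, Matrix.diag, Matrix.mul_apply, phiPlusProj, dotProduct, mulVec, sv,
    Finset.mul_sum, Pi.star_apply]
  refine Finset.sum_congr rfl fun x _ => Finset.sum_congr rfl fun y _ => ?_
  by_cases h1 : x.1 = x.2 <;> by_cases h2 : y.1 = y.2 <;> simp [h1, h2, mul_comm]

lemma trace_ptrace (d : ℕ) (ρ : Matrix (Fin d × Fin d) (Fin d × Fin d) ℂ) :
    (ptraceB d ρ).trace = ρ.trace := by
  simp [Matrix.trace, ptraceB, Fintype.sum_prod_type]

lemma re_of_nonneg {z : ℂ} (h : 0 ≤ z) : z = (z.re : ℂ) := by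
  rw [Complex.nonneg_iff] at h
  apply Complex.ext <;> simp [h.2.symm]

lemma norm_dot_sq {d : ℕ} (a y : Fin d → ℂ) :
    ‖∑ j, a j * y j‖ ^ 2 ≤ (∑ j, ‖a j‖ ^ 2) * ∑ j, ‖y j‖ ^ 2 := by
  refine le_trans ?_ (Finset.sum_mul_sq_le_sq_mul_sq _ _ _)
  gcongr
  refine (norm_sum_le _ _).trans (le_of_eq ?_)
  simp

lemma star_dot_self {d : ℕ} (y : Fin d → ℂ) :
    star y ⬝ᵥ y = ((∑ j, ‖y j‖ ^ 2 : ℝ) : ℂ) := by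
  simp only [dotProduct, Pi.star_apply, RCLike.star_def, Complex.conj_mul']
  push_cast
  rfl

lemma core {d : ℕ} {ρ : Matrix (Fin d × Fin d) (Fin d × Fin d) ℂ} (hρ : ρ.PosSemidef)
    {σ : Matrix (Fin d) (Fin d) ℂ} (hσ : σ.PosSemidef) (hσtr : σ.trace = 1)
    {c : ℝ} (hc : 0 ≤ c)
    (hdom : ((c : ℂ) • Matrix.kroneckerMap (· * ·) (ptraceB d ρ) σ - ρ).PosSemidef)
    {B W : Matrix (Fin d) (Fin d) ℂ} (hB : B.PosSemidef)
    (hle : (B - ptraceB d ρ).PosSemidef)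
    (hW : vc (B * W) = ρ *ᵥ sv d) :
    (star (sv d) ⬝ᵥ ρ *ᵥ sv d).re ^ 2 ≤ c * B.trace.re ^ 2 := by
  set G := (star (sv d) ⬝ᵥ ρ *ᵥ sv d).re with hGdef
  have hG0 : 0 ≤ G := (Complex.nonneg_iff.1 (hρ.dotProduct_mulVec_nonneg _)).1
  have hGc : star (sv d) ⬝ᵥ ρ *ᵥ sv d = (G : ℂ) := re_of_nonneg (hρ.dotProduct_mulVec_nonneg _)
  set A := ptraceB d ρ with hA
  have hApsd : A.PosSemidef := ptrace_psd hρ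
  have hAB : ∀ x, (star x ⬝ᵥ A *ᵥ x).re ≤ (star x ⬝ᵥ B *ᵥ x).re := by
    intro x
    have := (Complex.nonneg_iff.1 (hle.dotProduct_mulVec_nonneg x)).1
    rw [Matrix.sub_mulVec, dotProduct_sub, Complex.sub_re] at this
    linarith
  have hM : ∀ x : Fin d → ℂ, ∑ j, ‖∑ i, star (x i) * (B * W) i j‖ ^ 2
      ≤ G * (star x ⬝ᵥ A *ᵥ x).re := by
    intro x
    rw [hA, ptrace_form, Complex.re_sum, Finset.mul_sum]
    refine Finset.sum_le_sum fun j _ => ?_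
    have h := psd_cs hρ (tens x j) (sv d)
    rw [tens_dot] at h
    have e : ∀ i, (ρ *ᵥ sv d) (i, j) = (B * W) i j := fun i => by rw [← hW]; rfl
    simp only [e] at h
    rw [mul_comm]
    exact h
  have hWA : ∀ y : Fin d → ℂ, (star (W *ᵥ y) ⬝ᵥ A *ᵥ (W *ᵥ y)).re ≤ G * ∑ j, ‖y j‖ ^ 2 := by
    intro y
    refine (hAB _).trans ?_
    set x := W *ᵥ y with hx
    set q := (star x ⬝ᵥ B *ᵥ x).re with hq
    have hq0 : 0 ≤ q := (Complex.nonneg_iff.1 (hB.dotProduct_mulVec_nonneg x)).1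
    have e : star x ⬝ᵥ B *ᵥ x = ∑ j, (∑ i, star (x i) * (B * W) i j) * y j := by
      conv_lhs => rw [hx, Matrix.mulVec_mulVec, Matrix.dotProduct_mulVec, ← hx]
      rfl
    have h1 := norm_dot_sq (fun j => ∑ i, star (x i) * (B * W) i j) y
    rw [← e, re_of_nonneg (hB.dotProduct_mulVec_nonneg x), ← hq, Complex.norm_real, Real.norm_eq_abs,
      sq_abs] at h1
    have hN : 0 ≤ ∑ j, ‖y j‖ ^ 2 := by positivity
    have h2 : q ^ 2 ≤ (G * q) * ∑ j, ‖y j‖ ^ 2 :=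
      h1.trans (mul_le_mul_of_nonneg_right
        ((hM x).trans (mul_le_mul_of_nonneg_left (hAB x) hG0)) hN)
    rcases hq0.eq_or_lt with h0 | h0
    · rw [← h0]; positivity
    · exact le_of_mul_le_mul_left (by nlinarith) h0
  have hK : ((G : ℂ) • (1 : Matrix (Fin d) (Fin d) ℂ) - Wᴴ * A * W).PosSemidef := by
    refine Matrix.PosSemidef.of_dotProduct_mulVec_nonneg ?_ fun y => ?_
    · refine Matrix.IsHermitian.sub ?_ (hApsd.conjTranspose_mul_mul_same W).1
      exact (Matrix.PosSemidef.one.smul (a := (G : ℂ)) (by exact_mod_cast hG0)).1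
    · have e : star y ⬝ᵥ (Wᴴ * A * W) *ᵥ y = star (W *ᵥ y) ⬝ᵥ A *ᵥ (W *ᵥ y) := by
        rw [Matrix.mul_assoc, ← Matrix.mulVec_mulVec, Matrix.dotProduct_mulVec, ← Matrix.star_mulVec,
          Matrix.mulVec_mulVec]
      rw [Matrix.sub_mulVec, dotProduct_sub, e, Matrix.smul_mulVec, Matrix.one_mulVec,
        dotProduct_smul, star_dot_self, re_of_nonneg (hApsd.dotProduct_mulVec_nonneg (W *ᵥ y)),
        smul_eq_mul, ← Complex.ofReal_mul, ← Complex.ofReal_sub]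
      exact_mod_cast sub_nonneg.2 (hWA y)
  -- upper bound on the product form
  have hup : ((Wᴴ * A * W) * σᵀ).trace.re ≤ G := by
    have h := (Complex.nonneg_iff.1 (psd_trace_mul hK hσ.transpose)).1
    rw [Matrix.sub_mul, Matrix.trace_sub, Matrix.smul_mul, Matrix.one_mul, Matrix.trace_smul,
      Matrix.trace_transpose, hσtr, smul_eq_mul, mul_one, Complex.sub_re, Complex.ofReal_re] at h
    linarith
  have hup2 : (star (vc W) ⬝ᵥ ρ *ᵥ vc W).re ≤ c * G := by
    have h := (Complex.nonneg_iff.1 (hdom.dotProduct_mulVec_nonneg (vc W))).1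
    rw [Matrix.sub_mulVec, dotProduct_sub, Matrix.smul_mulVec, dotProduct_smul, kron_form,
      smul_eq_mul, Complex.sub_re, Complex.re_ofReal_mul] at h
    nlinarith
  -- `T = Tr W† B W`
  have hBk : (Matrix.kroneckerMap (· * ·) B (1 : Matrix (Fin d) (Fin d) ℂ)).PosSemidef :=
    hB.kronecker Matrix.PosSemidef.one
  set T := (Wᴴ * B * W).trace.re with hT
  have hT0 : 0 ≤ (Wᴴ * B * W).trace := (hB.conjTranspose_mul_mul_same W).trace_nonneg
  have hTr : 0 ≤ T := (Complex.nonneg_iff.1 hT0).1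
  have hTc := re_of_nonneg hT0
  rw [← hT] at hTc
  have h1 : T ^ 2 ≤ (star (vc W) ⬝ᵥ ρ *ᵥ vc W).re * G := by
    have h := psd_cs hρ (vc W) (sv d)
    rw [← hW, vc_dot, ← Matrix.mul_assoc, hTc, Complex.norm_real, Real.norm_eq_abs, sq_abs, hW] at h
    exact h
  have h2 : G ^ 2 ≤ B.trace.re * T := by
    have h := psd_cs hBk (vc 1) (vc W)
    simp only [kron_form, Matrix.transpose_one, Matrix.mul_one, Matrix.conjTranspose_one,
      Matrix.one_mul] at h
    have e : (B * W).trace = (G : ℂ) := by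
      rw [← hGc, ← hW, sv_eq, vc_dot]; simp
    rw [e, Complex.norm_real, Real.norm_eq_abs, sq_abs] at h
    exact h
  have hb : 0 ≤ B.trace.re := (Complex.nonneg_iff.1 hB.trace_nonneg).1
  rcases hG0.eq_or_lt with h0 | h0
  · rw [← h0, zero_pow two_ne_zero]; positivity
  · have h3 : T ^ 2 ≤ c * G ^ 2 := by nlinarith
    have h4 : (G ^ 2) ^ 2 ≤ (B.trace.re * T) ^ 2 := by gcongr
    have h5 : G ^ 2 * G ^ 2 ≤ G ^ 2 * (c * B.trace.re ^ 2) := by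
      nlinarith [mul_le_mul_of_nonneg_left h3 (sq_nonneg B.trace.re)]
    exact le_of_mul_le_mul_left h5 (by positivity)

lemma core2 {d : ℕ} {ρ : Matrix (Fin d × Fin d) (Fin d × Fin d) ℂ} (hρ : ρ.PosSemidef)
    (hρtr : ρ.trace = 1)
    {σ : Matrix (Fin d) (Fin d) ℂ} (hσ : σ.PosSemidef) (hσtr : σ.trace = 1)
    {c : ℝ} (hc : 0 ≤ c)
    (hdom : ((c : ℂ) • Matrix.kroneckerMap (· * ·) (ptraceB d ρ) σ - ρ).PosSemidef)
    (δ : ℝ) (hδ : 0 < δ) :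
    (star (sv d) ⬝ᵥ ρ *ᵥ sv d).re ^ 2 ≤ c * (1 + δ * d) ^ 2 := by
  have h1 : ((δ : ℂ) • (1 : Matrix (Fin d) (Fin d) ℂ)).PosDef :=
    Matrix.PosDef.one.smul (by exact_mod_cast hδ)
  have hB : (ptraceB d ρ + (δ : ℂ) • (1 : Matrix (Fin d) (Fin d) ℂ)).PosDef :=
    Matrix.PosDef.posSemidef_add (ptrace_psd hρ) h1
  have hu := (Matrix.isUnit_iff_isUnit_det _).1 hB.isUnit
  have h := core hρ hσ hσtr hc hdom hB.posSemidef (by simpa using h1.posSemidef)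
    (W := (ptraceB d ρ + (δ : ℂ) • (1 : Matrix (Fin d) (Fin d) ℂ))⁻¹ *
      Matrix.of fun i j => (ρ *ᵥ sv d) (i, j))
    (by rw [Matrix.mul_nonsing_inv_cancel_left _ _ hu]; rfl)
  have e : (ptraceB d ρ + (δ : ℂ) • (1 : Matrix (Fin d) (Fin d) ℂ)).trace.re = 1 + δ * d := by
    rw [Matrix.trace_add, trace_ptrace, hρtr, Matrix.trace_smul, Matrix.trace_one]
    simp
  rwa [e] at h

/-- Lower bound on the smooth max-mutual information of the
maximally entangled state: if `ρ` is a state on `ℂ^d ⊗ ℂ^d` with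
`⟨φ⁺|ρ|φ⁺⟩ ≥ 1-ε²`, `σ` is a state on `ℂ^d`, and `c·(ρ_A ⊗ σ) - ρ ≥ 0`,
then `c ≥ d²(1-ε²)²`. -/
theorem Imax_lower_bound (d : ℕ) (hd : 1 ≤ d) (ε : ℝ) (hε0 : 0 ≤ ε) (hε1 : ε ≤ 1)
    (ρ : Matrix (Fin d × Fin d) (Fin d × Fin d) ℂ)
    (hρ : ρ.PosSemidef) (hρtr : ρ.trace = 1)
    (hfid : 1 - ε ^ 2 ≤ (Matrix.trace (ρ * phiPlusProj d)).re)
    (σ : Matrix (Fin d) (Fin d) ℂ) (hσ : σ.PosSemidef) (hσtr : σ.trace = 1)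
    (c : ℝ) (hc : 0 ≤ c)
    (hdom : ((c : ℂ) • Matrix.kroneckerMap (· * ·) (ptraceB d ρ) σ - ρ).PosSemidef) :
    (d : ℝ) ^ 2 * (1 - ε ^ 2) ^ 2 ≤ c := by
  have hG : (d : ℝ) * (1 - ε ^ 2) ≤ (star (sv d) ⬝ᵥ ρ *ᵥ sv d).re := by
    rw [trace_phi, ← Complex.ofReal_natCast, ← Complex.ofReal_inv, Complex.re_ofReal_mul] at hfid
    have hd' : (0 : ℝ) < d := by exact_mod_cast hd
    calc (d : ℝ) * (1 - ε ^ 2) ≤ d * ((d : ℝ)⁻¹ * (star (sv d) ⬝ᵥ ρ *ᵥ sv d).re) := by gcongr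
      _ = _ := by field_simp
  have h0 : 0 ≤ (d : ℝ) * (1 - ε ^ 2) := mul_nonneg (by positivity) (by nlinarith)
  have hlim : Filter.Tendsto (fun δ : ℝ => c * (1 + δ * d) ^ 2) (nhdsWithin 0 (Set.Ioi 0))
      (nhds (c * (1 + 0 * d) ^ 2)) :=
    (Continuous.tendsto (by fun_prop) 0).mono_left nhdsWithin_le_nhds
  have h := ge_of_tendsto hlim (Filter.eventually_of_mem self_mem_nhdsWithin
    fun δ hδ => core2 hρ hρtr hσ hσtr hc hdom δ hδ)
  calc (d : ℝ) ^ 2 * (1 - ε ^ 2) ^ 2 = (d * (1 - ε ^ 2)) ^ 2 := by ring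
    _ ≤ _ := by gcongr
    _ ≤ _ := h
    _ = c := by ring

end PBT
end

section
/- Let G be a group, d ≥ 1 an integer, φ : G → U(d) a homomorphism into the d×d unitary matrices, and ρ a density matrix on ℂ^d commuting with φ(g) for all g ∈ G. Then there exists a unit vector v ∈ ℂ^d ⊗ ℂ^d such that (i) the partial trace over the second factor of the rank-one projector |v⟩⟨v| equals ρ, i.e. ∑_{k=1}^d v_{ik} · conj(v_{jk}) = ρ_{ij} for all i,j, and (ii) (φ(g) ⊗ conj(φ(g))) v = v for all g ∈ G, where conj denotes entrywise complex conjugation. -/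
open scoped BigOperators ComplexOrder
open Finset

namespace PBT

open scoped MatrixOrder in
lemma exists_sqrt_commute {d : ℕ} (ρ : Matrix (Fin d) (Fin d) ℂ) (hρ : ρ.PosSemidef) :
    ∃ S : Matrix (Fin d) (Fin d) ℂ, S * S.conjTranspose = ρ ∧
      ∀ U : Matrix (Fin d) (Fin d) ℂ, ρ * U = U * ρ → S * U = U * S := by
  refine ⟨CFC.sqrt ρ, ?_, ?_⟩
  · have h : (CFC.sqrt ρ).PosSemidef :=
      Matrix.nonneg_iff_posSemidef.mp (CFC.sqrt_nonneg ρ)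
    rw [h.1.eq]
    exact CFC.sqrt_mul_sqrt_self ρ hρ.nonneg
  · intro U hU
    rw [CFC.sqrt_eq_cfc]
    exact Commute.cfc_nnreal (show Commute ρ U from hU) _

/-- A state invariant under a unitary representation admits a
purification invariant under the representation tensored with its dual: if `ρ`
commutes with all `φ(g)`, there is a unit vector `v ∈ ℂ^d ⊗ ℂ^d` purifying `ρ`
(item (i)) with `(φ(g) ⊗ conj(φ(g))) v = v` for all `g` (item (ii)). -/
theorem symmetric_purification (G : Type*) [Group G] (d : ℕ) (hd : 1 ≤ d)
    (φ : G →* Matrix.unitaryGroup (Fin d) ℂ)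
    (ρ : Matrix (Fin d) (Fin d) ℂ) (hρ : ρ.PosSemidef) (hρtr : ρ.trace = 1)
    (hcomm : ∀ g : G, ρ * (φ g : Matrix (Fin d) (Fin d) ℂ) =
      (φ g : Matrix (Fin d) (Fin d) ℂ) * ρ) :
    ∃ v : Fin d × Fin d → ℂ,
      (∑ x : Fin d × Fin d, Complex.normSq (v x)) = 1 ∧
      (∀ i j : Fin d, ∑ k : Fin d, v (i, k) * (starRingEnd ℂ) (v (j, k)) = ρ i j) ∧
      (∀ g : G,
        (Matrix.kroneckerMap (· * ·) (φ g : Matrix (Fin d) (Fin d) ℂ)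
          ((φ g : Matrix (Fin d) (Fin d) ℂ).map (starRingEnd ℂ))).mulVec v = v) := by
  obtain ⟨S, hS, hSc⟩ := exists_sqrt_commute ρ hρ
  have hi : ∀ i j : Fin d, ∑ k : Fin d, S i k * (starRingEnd ℂ) (S j k) = ρ i j := by
    intro i j
    rw [← hS]
    simp [Matrix.mul_apply]
  refine ⟨fun x => S x.1 x.2, ?_, hi, ?_⟩
  · apply Complex.ofReal_injective
    rw [Complex.ofReal_one, ← hρtr, Matrix.trace, Fintype.sum_prod_type, Complex.ofReal_sum]
    refine Finset.sum_congr rfl fun i _ => ?_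
    rw [Matrix.diag_apply, ← hi i i, Complex.ofReal_sum]
    exact Finset.sum_congr rfl fun k _ => (Complex.mul_conj _).symm
  · intro g
    have hU : (φ g : Matrix (Fin d) (Fin d) ℂ) * star (φ g : Matrix (Fin d) (Fin d) ℂ) = 1 :=
      Matrix.mem_unitaryGroup_iff.mp (φ g).2
    have h : (φ g : Matrix (Fin d) (Fin d) ℂ) * S *
        star (φ g : Matrix (Fin d) (Fin d) ℂ) = S := by
      rw [← hSc _ (hcomm g), Matrix.mul_assoc, hU, Matrix.mul_one]
    funext ⟨i, k⟩
    have h2 := congrFun (congrFun h i) k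
    simp only [Matrix.mul_apply, Matrix.star_apply, Finset.sum_mul] at h2
    rw [Finset.sum_comm] at h2
    rw [Matrix.mulVec, dotProduct, Fintype.sum_prod_type]
    refine Eq.trans ?_ h2
    refine Finset.sum_congr rfl fun a _ => Finset.sum_congr rfl fun b _ => ?_
    simp only [Matrix.kroneckerMap_apply, Matrix.map_apply, starRingEnd_apply]
    ring

end PBT
end

section
/- Let x_1, x_2, x_3 be independent real centered Gaussian random variables each of variance 1/2, and let G be the random 2×2 Hermitian matrix G := x_1·σ_1 + x_2·σ_2 + x_3·σ_3, where σ_1 = [[0,1],[1,0]], σ_2 = [[0,−i],[i,0]], σ_3 = [[1,0],[0,−1]] are the Pauli matrices. Then the largest eigenvalue of G equals √(x_1² + x_2² + x_3²) pointwise, and its expectation is E[λ_max(G)] = 2/√π. (Equivalently, √2·λ_max(G) has the chi distribution with three degrees of freedom, and the expected largest eigenvalue of the traceless GUE of dimension 2 equals 2/√π.) -/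
open scoped BigOperators
open MeasureTheory ProbabilityTheory

namespace PBT

/-- The random 2×2 Hermitian matrix `G = x₁σ₁ + x₂σ₂ + x₃σ₃` (Pauli matrices),
with `x₁ = ω 0`, `x₂ = ω 1`, `x₃ = ω 2`. -/
noncomputable def pauliG (ω : Fin 3 → ℝ) : Matrix (Fin 2) (Fin 2) ℂ :=
  !![((ω 2 : ℝ) : ℂ), ((ω 0 : ℝ) : ℂ) - ((ω 1 : ℝ) : ℂ) * Complex.I;
     ((ω 0 : ℝ) : ℂ) + ((ω 1 : ℝ) : ℂ) * Complex.I, -((ω 2 : ℝ) : ℂ)]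

/-- The largest eigenvalue of a Hermitian matrix (junk value `0` otherwise). -/
noncomputable def lambdaMax {d : ℕ} (M : Matrix (Fin d) (Fin d) ℂ) : ℝ :=
  if h : M.IsHermitian then ⨆ i, h.eigenvalues i else 0

/-- The probability measure of three independent centered Gaussians of
variance 1/2. -/
noncomputable def gauss3 : Measure (Fin 3 → ℝ) :=
  Measure.pi fun _ => gaussianReal 0 (1 / 2)

theorem pauliG_herm (ω : Fin 3 → ℝ) : (pauliG ω).IsHermitian := by
  ext i j
  fin_cases i <;> fin_cases j <;> simp [pauliG, Matrix.conjTranspose_apply] <;> ring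

theorem lambdaMax_pauliG (ω : Fin 3 → ℝ) :
    lambdaMax (pauliG ω) = Real.sqrt ((ω 0) ^ 2 + (ω 1) ^ 2 + (ω 2) ^ 2) := by
  have h := pauliG_herm ω
  have hd := h.det_eq_prod_eigenvalues
  have ht := h.trace_eq_sum_eigenvalues
  rw [lambdaMax, dif_pos h]
  simp only [Fin.prod_univ_two, Fin.sum_univ_two] at hd ht
  generalize h.eigenvalues = e at hd ht ⊢
  have ht1 : e 0 + e 1 = 0 := by
    have : ((e 0 + e 1 : ℝ) : ℂ) = 0 := by
      push_cast
      rw [show ((e 0 : ℂ)) + (e 1 : ℂ) = _ from ht.symm]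
      simp [pauliG, Matrix.trace]
    exact_mod_cast this
  have hd1 : e 0 * e 1 = -((ω 0) ^ 2 + (ω 1) ^ 2 + (ω 2) ^ 2) := by
    have : ((e 0 * e 1 : ℝ) : ℂ) = ((-((ω 0) ^ 2 + (ω 1) ^ 2 + (ω 2) ^ 2) : ℝ) : ℂ) := by
      push_cast
      rw [show ((e 0 : ℂ)) * (e 1 : ℂ) = _ from hd.symm]
      simp only [pauliG, Matrix.det_fin_two_of]
      linear_combination ((ω 1 : ℂ)) ^ 2 * Complex.I_sq
    exact_mod_cast this
  have he : (⨆ i, e i) = max (e 0) (e 1) := by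
    apply le_antisymm
    · apply ciSup_le
      intro i
      fin_cases i
      · exact le_max_left _ _
      · exact le_max_right _ _
    · have hb : BddAbove (Set.range e) := (Set.finite_range e).bddAbove
      exact max_le (le_ciSup hb 0) (le_ciSup hb 1)
  rw [he]
  have h1 : e 1 = - e 0 := by linarith
  rw [h1, ← abs_eq_max_neg]
  rw [← Real.sqrt_sq_eq_abs]
  congr 1
  rw [h1] at hd1
  linarith

theorem gauss3_eq : gauss3 = (volume : Measure (Fin 3 → ℝ)).withDensity
    (fun ω => ENNReal.ofReal (∏ i, gaussianPDFReal 0 (1 / 2) (ω i))) := by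
  have hv : (1 / 2 : NNReal) ≠ 0 := by norm_num
  refine Measure.pi_eq fun s hs => ?_
  rw [withDensity_apply _ (MeasurableSet.univ_pi hs), volume_pi, Measure.restrict_pi_pi,
    ← ofReal_integral_eq_lintegral_ofReal]
  · rw [integral_fintype_prod_eq_prod (fun _ : Fin 3 => gaussianPDFReal 0 (1 / 2)),
      ENNReal.ofReal_prod_of_nonneg]
    · refine Finset.prod_congr rfl fun i _ => ?_
      rw [gaussianReal_apply_eq_integral _ hv]
    · intro i _
      exact integral_nonneg fun x => gaussianPDFReal_nonneg _ _ _
  · exact Integrable.fintype_prod (f := fun _ : Fin 3 => gaussianPDFReal 0 (1 / 2))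
      fun i => (integrable_gaussianPDFReal _ _).restrict
  · exact Filter.Eventually.of_forall fun ω =>
      Finset.prod_nonneg fun i _ => gaussianPDFReal_nonneg _ _ _

theorem integral_norm_gauss3 :
    (∫ ω, Real.sqrt ((ω 0) ^ 2 + (ω 1) ^ 2 + (ω 2) ^ 2) ∂gauss3) = 2 / Real.sqrt Real.pi := by
  have hpi := Real.pi_pos
  have hm : Measurable (fun ω : Fin 3 → ℝ => ∏ i, gaussianPDFReal 0 (1 / 2) (ω i)) :=
    Finset.measurable_prod _ fun i _ =>
      (measurable_gaussianPDFReal 0 (1 / 2)).comp (measurable_pi_apply i)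
  have hnn : ∀ ω : Fin 3 → ℝ, 0 ≤ ∏ i, gaussianPDFReal 0 (1 / 2) (ω i) := fun ω =>
    Finset.prod_nonneg fun i _ => gaussianPDFReal_nonneg _ _ _
  rw [gauss3_eq, integral_withDensity_eq_integral_toReal_smul hm.ennreal_ofReal
    (Filter.Eventually.of_forall fun _ => ENNReal.ofReal_lt_top)]
  have key : ∀ ω : Fin 3 → ℝ, (ENNReal.ofReal (∏ i, gaussianPDFReal 0 (1 / 2) (ω i))).toReal •
      Real.sqrt ((ω 0) ^ 2 + (ω 1) ^ 2 + (ω 2) ^ 2) =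
      (fun r : ℝ => (Real.sqrt Real.pi)⁻¹ ^ 3 * (Real.exp (-r ^ 2) * r))
        ‖(WithLp.toLp 2 ω : EuclideanSpace ℝ (Fin 3))‖ := by
    intro ω
    rw [ENNReal.toReal_ofReal (hnn ω)]
    have hn : ‖(WithLp.toLp 2 ω : EuclideanSpace ℝ (Fin 3))‖
        = Real.sqrt ((ω 0) ^ 2 + (ω 1) ^ 2 + (ω 2) ^ 2) := by
      simp [EuclideanSpace.norm_eq, Fin.sum_univ_three]
    simp only [hn, smul_eq_mul]
    rw [Real.sq_sqrt (by positivity), ← mul_assoc]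
    congr 1
    simp only [Fin.prod_univ_three, gaussianPDFReal]
    have h2 : (2 : ℝ) * Real.pi * ((1 / 2 : NNReal) : ℝ) = Real.pi := by push_cast; ring
    have h3 : ∀ x : ℝ, -(x - 0) ^ 2 / (2 * ((1 / 2 : NNReal) : ℝ)) = - x ^ 2 := by
      intro x; push_cast; ring
    simp only [h2, h3]
    rw [neg_add, neg_add, Real.exp_add, Real.exp_add]
    ring
  simp_rw [key]
  rw [(PiLp.volume_preserving_toLp (Fin 3)).integral_comp
    (MeasurableEquiv.toLp 2 (Fin 3 → ℝ)).measurableEmbedding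
    (fun x : EuclideanSpace ℝ (Fin 3) =>
      (fun r : ℝ => (Real.sqrt Real.pi)⁻¹ ^ 3 * (Real.exp (-r ^ 2) * r)) ‖x‖)]
  rw [integral_fun_norm_addHaar volume
    (fun r : ℝ => (Real.sqrt Real.pi)⁻¹ ^ 3 * (Real.exp (-r ^ 2) * r))]
  have hI : ∫ y in Set.Ioi (0 : ℝ), y ^ (3 - 1) • ((Real.sqrt Real.pi)⁻¹ ^ 3 *
      (Real.exp (-y ^ 2) * y)) = (Real.sqrt Real.pi)⁻¹ ^ 3 * (1 / 2) := by
    have := integral_rpow_mul_exp_neg_rpow (p := 2) (q := 3) (by norm_num) (by norm_num)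
    rw [show ((3 : ℝ) + 1) / 2 = 1 + 1 by norm_num, Real.Gamma_add_one one_ne_zero,
      Real.Gamma_one] at this
    rw [show (1 / 2 : ℝ) = 1 / 2 * (1 * 1) by norm_num, ← this, ← integral_const_mul]
    congr 1
    ext y
    rw [show (3 : ℝ) = ((3 : ℕ) : ℝ) by norm_num, show (2 : ℝ) = ((2 : ℕ) : ℝ) by norm_num,
      Real.rpow_natCast, Real.rpow_natCast, smul_eq_mul]
    ring
  rw [finrank_euclideanSpace, Fintype.card_fin, hI, Measure.real,
    EuclideanSpace.volume_ball_fin_three]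
  rw [ENNReal.toReal_mul, ENNReal.toReal_ofReal (by positivity)]
  simp only [ENNReal.ofReal_one, one_pow, ENNReal.toReal_one, nsmul_eq_mul, smul_eq_mul]
  have hs : Real.sqrt Real.pi ^ 2 = Real.pi := Real.sq_sqrt hpi.le
  have hs0 : Real.sqrt Real.pi ≠ 0 := by positivity
  field_simp
  rw [hs]
  push_cast
  ring

/-- For `G = x₁σ₁ + x₂σ₂ + x₃σ₃` with `x_i` independent centered
Gaussians of variance 1/2: pointwise `λ_max(G) = √(x₁² + x₂² + x₃²)`, and
`E[λ_max(G)] = 2/√π`. -/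
theorem gue0_two_dim_lambdaMax :
    (∀ ω : Fin 3 → ℝ,
      lambdaMax (pauliG ω) = Real.sqrt ((ω 0) ^ 2 + (ω 1) ^ 2 + (ω 2) ^ 2)) ∧
    (∫ ω, lambdaMax (pauliG ω) ∂gauss3) = 2 / Real.sqrt Real.pi := by
  refine ⟨lambdaMax_pauliG, ?_⟩
  simp_rw [lambdaMax_pauliG]
  exact integral_norm_gauss3

end PBT
end
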